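/- Let n ≥ 2, let a ∈ ℝ, let r_1, …, r_{n+1} be nonnegative integers such that r_i ≠ r_j for some 1 ≤ i < j ≤ n, let U ⊆ ℝ^n be an open set, and let P : ℝ^n → ℝ^n be a smooth map whose derivative has rank n at every point of U. Define the polynomial function f(x,y) = a·y^{r_{n+1}} + Σ_{k=1}^{n} P_k(x)·y^{r_k} for x ∈ ℝ^n, y ∈ ℝ. If A ⊆ U and B ⊆ ℝ are compact sets with dim_H A + dim_H B > n, then there exists y ∈ B such that the set f(A,y) = { f(x,y) : x ∈ A } has positive one-dimensional Lebesgue measure. -/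

import Mathlib

open MeasureTheory
open scoped ENNReal

section Fourier
open Complex Module

variable {E : Type*} [NormedAddCommGroup E] [InnerProductSpace ℝ E] [FiniteDimensional ℝ E]
  [MeasurableSpace E] [BorelSpace E]

lemma integral_charFun_add_mul_gaussian (τ : Measure E) [IsFiniteMeasure τ] {b : ℝ}
    (hb : 0 < b) (z : E) :
    ∫ w, charFun τ (z + w) * cexp (-b * ‖w‖ ^ 2) =
      ((Real.pi / b) ^ (finrank ℝ E / 2 : ℝ) : ℝ) *
        ∫ x, cexp (inner ℝ x z * I) * (Real.exp (-‖x‖ ^ 2 / (4 * b)) : ℝ) ∂τ := by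
  have hb' : 0 < (b : ℂ).re := by simpa
  have key : ∀ x : E, ∫ w, cexp (inner ℝ x z * I) * cexp (-b * ‖w‖ ^ 2 + I * inner ℝ x w) =
      ((Real.pi / b) ^ (finrank ℝ E / 2 : ℝ) : ℝ) *
        (cexp (inner ℝ x z * I) * (Real.exp (-‖x‖ ^ 2 / (4 * b)) : ℝ)) := by
    intro x
    rw [integral_const_mul, GaussianFourier.integral_cexp_neg_mul_sq_norm_add hb' I x]
    push_cast
    rw [Complex.ofReal_cpow (by positivity)]
    simp
    ring
  have hint : Integrable (fun p : E × E =>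
      cexp (inner ℝ p.2 z * I) * cexp (-b * ‖p.1‖ ^ 2 + I * inner ℝ p.2 p.1))
      (volume.prod τ) := by
    have h1 : Integrable (fun w : E => cexp (-b * ‖w‖ ^ 2)) := by
      simpa using GaussianFourier.integrable_cexp_neg_mul_sq_norm_add hb' 0 (0 : E)
    refine (h1.comp_fst τ).mono (by fun_prop) (ae_of_all _ fun p => ?_)
    simp [Complex.norm_exp]
  calc ∫ w, charFun τ (z + w) * cexp (-b * ‖w‖ ^ 2)
      = ∫ w, ∫ x, cexp (inner ℝ x z * I) * cexp (-b * ‖w‖ ^ 2 + I * inner ℝ x w) ∂τ := by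
        congr 1 with w
        rw [charFun_apply, ← integral_mul_const]
        congr 1 with x
        rw [← Complex.exp_add, ← Complex.exp_add, inner_add_right]
        push_cast
        ring_nf
    _ = ∫ x, (∫ w, cexp (inner ℝ x z * I) * cexp (-b * ‖w‖ ^ 2 + I * inner ℝ x w)) ∂τ :=
        integral_integral_swap
          (f := fun w x => cexp (inner ℝ x z * I) * cexp (-b * ‖w‖ ^ 2 + I * inner ℝ x w)) hint
    _ = _ := by
        simp_rw [key]
        rw [integral_const_mul]

lemma integrable_exp_neg_mul_sq_norm {b : ℝ} (hb : 0 < b) :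
    Integrable (fun w : E => Real.exp (-b * ‖w‖ ^ 2)) := by
  refine (GaussianFourier.integrable_cexp_neg_mul_sq_norm_add (V := E) (b := b)
    (by simpa) 0 0).norm.congr (ae_of_all _ fun w => ?_)
  simp [Complex.norm_exp, ← Complex.ofReal_pow]

lemma lintegral_charFun_sq_mul_gaussian (σ : Measure E) [IsFiniteMeasure σ] {b : ℝ}
    (hb : 0 < b) :
    ∫⁻ w, ‖charFun σ w‖ₑ ^ 2 * ENNReal.ofReal (Real.exp (-b * ‖w‖ ^ 2)) =
      ENNReal.ofReal ((Real.pi / b) ^ (finrank ℝ E / 2 : ℝ)) *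
        ∫⁻ x, ∫⁻ y, ENNReal.ofReal (Real.exp (-‖x - y‖ ^ 2 / (4 * b))) ∂σ ∂σ := by
  set τ : Measure E := (σ.prod σ).map (fun p => p.1 - p.2) with hτ
  have hτchar : ∀ w, charFun τ w = ((‖charFun σ w‖ ^ 2 : ℝ) : ℂ) := by
    intro w
    rw [charFun_apply, hτ, integral_map (by fun_prop) (by fun_prop)]
    have : ∀ p : E × E, cexp (inner ℝ (p.1 - p.2) w * I) =
        cexp (inner ℝ p.1 w * I) * cexp (inner ℝ p.2 (-w) * I) := by
      intro p
      rw [← Complex.exp_add, inner_sub_left, inner_neg_right]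
      push_cast
      ring_nf
    simp_rw [this]
    rw [integral_prod_mul (fun x : E => cexp (inner ℝ x w * I))
      (fun x : E => cexp (inner ℝ x (-w) * I)), ← charFun_apply, ← charFun_apply, charFun_neg,
      Complex.mul_conj, Complex.normSq_eq_norm_sq]
  have h := integral_charFun_add_mul_gaussian τ hb 0
  simp only [zero_add, inner_zero_right, Complex.ofReal_zero, zero_mul, Complex.exp_zero,
    one_mul] at h
  have e1 : ∀ w, charFun τ w * cexp (-b * ‖w‖ ^ 2) =
      ((‖charFun σ w‖ ^ 2 * Real.exp (-b * ‖w‖ ^ 2) : ℝ) : ℂ) := by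
    intro w
    rw [hτchar]
    push_cast
    rfl
  simp_rw [e1] at h
  rw [integral_complex_ofReal, integral_complex_ofReal, ← Complex.ofReal_mul,
    Complex.ofReal_inj] at h
  have hg := integrable_exp_neg_mul_sq_norm (E := E) hb
  have hi : Integrable (fun w : E => ‖charFun σ w‖ ^ 2 * Real.exp (-b * ‖w‖ ^ 2)) := by
    refine hg.bdd_mul (c := σ.real Set.univ ^ 2) ?_ (ae_of_all _ fun w => ?_)
    · exact (measurable_charFun.norm.pow_const 2).aestronglyMeasurable
    · rw [norm_pow, norm_norm]
      gcongr
      exact norm_charFun_le w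
  have hi2 : Integrable (fun x : E => Real.exp (-‖x‖ ^ 2 / (4 * b))) τ := by
    refine Integrable.of_bound (by fun_prop) 1 (ae_of_all _ fun x => ?_)
    rw [Real.norm_eq_abs, Real.abs_exp, Real.exp_le_one_iff]
    exact div_nonpos_of_nonpos_of_nonneg (by simp) (by positivity)
  calc ∫⁻ w, ‖charFun σ w‖ₑ ^ 2 * ENNReal.ofReal (Real.exp (-b * ‖w‖ ^ 2))
      = ∫⁻ w, ENNReal.ofReal (‖charFun σ w‖ ^ 2 * Real.exp (-b * ‖w‖ ^ 2)) := by
        congr 1 with w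
        rw [ENNReal.ofReal_mul (by positivity), ENNReal.ofReal_pow (by positivity),
          ofReal_norm]
    _ = ENNReal.ofReal (∫ w, ‖charFun σ w‖ ^ 2 * Real.exp (-b * ‖w‖ ^ 2)) :=
        (ofReal_integral_eq_lintegral_ofReal hi (ae_of_all _ fun w => by positivity)).symm
    _ = _ := by
        rw [h, ENNReal.ofReal_mul (by positivity),
          ofReal_integral_eq_lintegral_ofReal hi2 (ae_of_all _ fun w => by positivity), hτ,
          lintegral_map (by fun_prop) (by fun_prop), lintegral_prod _ (by fun_prop)]

lemma enorm_sq_charFun_withDensity_gaussian_le (σ : Measure E) [IsFiniteMeasure σ] :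
    ∃ C : ℝ≥0∞, C ≠ ∞ ∧ ∀ z : E,
      ‖charFun (σ.withDensity fun x => ENNReal.ofReal (Real.exp (-‖x‖ ^ 2 / 2))) z‖ₑ ^ 2 ≤
        C * ∫⁻ w, ‖charFun σ w‖ₑ ^ 2 * ENNReal.ofReal (Real.exp (-‖w - z‖ ^ 2 / 2)) := by
  have hb : (0 : ℝ) < 1 / 2 := by norm_num
  set c : ℝ := (Real.pi / (1 / 2)) ^ (finrank ℝ E / 2 : ℝ) with hc
  have hcpos : 0 < c := by positivity
  set g : E → ℝ≥0∞ := fun w => ENNReal.ofReal (Real.exp (-(1 / 2) * ‖w‖ ^ 2)) with hg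
  have hgm : Measurable g := by fun_prop
  set G : ℝ≥0∞ := ∫⁻ w : E, g w with hG
  have hGtop : G ≠ ∞ := (integrable_exp_neg_mul_sq_norm (E := E) hb).lintegral_lt_top.ne
  have hcE : (ENNReal.ofReal c) ≠ 0 := by simpa using hcpos
  refine ⟨(ENNReal.ofReal c)⁻¹ ^ 2 * G, ENNReal.mul_ne_top (by simp [hcE]) hGtop, fun z => ?_⟩
  have hchar : c * charFun (σ.withDensity fun x => ENNReal.ofReal (Real.exp (-‖x‖ ^ 2 / 2))) z =
      ∫ w, charFun σ (z + w) * cexp (-(1 / 2 : ℝ) * ‖w‖ ^ 2) := by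
    rw [integral_charFun_add_mul_gaussian σ hb z, charFun_apply,
      integral_withDensity_eq_integral_toReal_smul (by fun_prop) (by simp)]
    congr 1
    refine integral_congr_ae (ae_of_all _ fun x => ?_)
    simp only [ENNReal.toReal_ofReal (Real.exp_pos _).le, Complex.real_smul]
    rw [mul_comm]
    norm_num
  have hle : ENNReal.ofReal c *
      ‖charFun (σ.withDensity fun x => ENNReal.ofReal (Real.exp (-‖x‖ ^ 2 / 2))) z‖ₑ ≤
        ∫⁻ w, ‖charFun σ (z + w)‖ₑ * g w := by
    have hcn : ENNReal.ofReal c = ‖(c : ℂ)‖ₑ := by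
      rw [← ofReal_norm, Complex.norm_real, Real.norm_of_nonneg hcpos.le]
    rw [hcn, ← enorm_mul, hchar]
    refine (enorm_integral_le_lintegral_enorm _).trans (lintegral_mono fun w => ?_)
    rw [enorm_mul, hg]
    gcongr
    rw [← ofReal_norm, Complex.norm_exp]
    simp [← Complex.ofReal_pow]
  have hcs : (∫⁻ w, ‖charFun σ (z + w)‖ₑ * g w) ^ 2 ≤
      (∫⁻ w, ‖charFun σ (z + w)‖ₑ ^ 2 * g w) * G := by
    have hm : Measurable fun w => ‖charFun σ (z + w)‖ₑ :=
      (measurable_charFun.comp (measurable_const_add z)).enorm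
    have := ENNReal.lintegral_mul_le_Lp_mul_Lq (volume.withDensity g) Real.HolderConjugate.two_two
      hm.aemeasurable (g := fun _ => 1) aemeasurable_const
    simp only [Pi.mul_apply, mul_one, ENNReal.one_rpow, lintegral_const, one_mul] at this
    rw [lintegral_withDensity_eq_lintegral_mul _ hgm hm,
      lintegral_withDensity_eq_lintegral_mul _ hgm (hm.pow_const _),
      withDensity_apply _ MeasurableSet.univ, setLIntegral_univ] at this
    calc _ ≤ _ := pow_le_pow_left' (by simpa [mul_comm] using this) 2
      _ = _ := by
        rw [mul_pow, ← ENNReal.rpow_natCast, ← ENNReal.rpow_natCast, ← ENNReal.rpow_mul,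
          ← ENNReal.rpow_mul]
        simp [mul_comm, hG]
  have htr : ∫⁻ w, ‖charFun σ (z + w)‖ₑ ^ 2 * g w =
      ∫⁻ w, ‖charFun σ w‖ₑ ^ 2 * ENNReal.ofReal (Real.exp (-‖w - z‖ ^ 2 / 2)) := by
    rw [← lintegral_add_left_eq_self (fun w => _ * ENNReal.ofReal (Real.exp (-‖w - z‖ ^ 2 / 2))) z]
    congr 1 with w
    simp only [hg, add_sub_cancel_left]
    ring_nf
  rw [← htr, mul_assoc, mul_comm G]
  refine le_trans ?_ (mul_le_mul_right (le_trans (pow_le_pow_left' hle 2) hcs) _)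
  rw [mul_pow, ← mul_assoc, ← mul_pow, ENNReal.inv_mul_cancel hcE (by simp), one_pow, one_mul]
end Fourier

lemma lintegral_exp_neg_le_of_measure_le {X : Type*} [MeasurableSpace X] {σ : Measure X}
    [SFinite σ] {h : X → ℝ} (hm : Measurable h) (h0 : ∀ x, 0 ≤ h x) {p : ℝ} (hp : 0 ≤ p)
    {C : ℝ≥0∞} (hC : ∀ u, 0 < u → σ {x | h x ≤ u} ≤ C * ENNReal.ofReal (u ^ p)) :
    ∫⁻ x, ENNReal.ofReal (Real.exp (-h x)) ∂σ ≤ C * ENNReal.ofReal (Real.Gamma (p + 1)) := by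
  have hexp : ∀ x, ENNReal.ofReal (Real.exp (-h x)) =
      ∫⁻ u in Set.Ioi 0, {u | h x ≤ u}.indicator (fun u => ENNReal.ofReal (Real.exp (-u))) u := by
    intro x
    have hint : IntegrableOn (fun u : ℝ => Real.exp (-u)) (Set.Ioi (h x)) :=
      integrableOn_exp_neg_Ioi (h x)
    rw [show {u | h x ≤ u} = Set.Ici (h x) from rfl, lintegral_indicator measurableSet_Ici,
      Measure.restrict_restrict measurableSet_Ici, ← integral_exp_neg_Ioi (h x),
      ofReal_integral_eq_lintegral_ofReal hint (ae_of_all _ fun u => (Real.exp_pos _).le)]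
    have hae : (Set.Ici (h x) ∩ Set.Ioi 0 : Set ℝ) =ᵐ[volume] (Set.Ici (h x) ∩ Set.Ici 0 : Set ℝ) :=
      ae_eq_set_inter (ae_eq_refl _) Ioi_ae_eq_Ici
    rw [Set.inter_eq_left.2 (Set.Ici_subset_Ici.2 (h0 x))] at hae
    exact setLIntegral_congr (Ioi_ae_eq_Ici.trans hae.symm)
  calc ∫⁻ x, ENNReal.ofReal (Real.exp (-h x)) ∂σ
      = ∫⁻ u in Set.Ioi 0, ∫⁻ x,
          {u | h x ≤ u}.indicator (fun u => ENNReal.ofReal (Real.exp (-u))) u ∂σ := by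
        simp_rw [hexp]
        refine lintegral_lintegral_swap (Measurable.aemeasurable ?_)
        exact Measurable.indicator (f := fun q : X × ℝ => ENNReal.ofReal (Real.exp (-q.2)))
          (s := {q : X × ℝ | h q.1 ≤ q.2}) (by fun_prop)
          (measurableSet_le (by fun_prop) (by fun_prop))
    _ = ∫⁻ u in Set.Ioi 0, ENNReal.ofReal (Real.exp (-u)) * σ {x | h x ≤ u} := by
        congr 1 with u
        rw [← lintegral_indicator_const (measurableSet_le hm measurable_const)]
        rfl
    _ ≤ ∫⁻ u in Set.Ioi 0, C * ENNReal.ofReal (Real.exp (-u) * u ^ p) := by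
        refine setLIntegral_mono (by fun_prop) fun u hu => ?_
        rw [ENNReal.ofReal_mul (Real.exp_pos _).le, mul_left_comm]
        gcongr
        exact hC u hu
    _ = C * ENNReal.ofReal (Real.Gamma (p + 1)) := by
        have hi := Real.GammaIntegral_convergent (s := p + 1) (by positivity)
        rw [add_sub_cancel_right] at hi
        rw [lintegral_const_mul _ (by fun_prop), Real.Gamma_eq_integral (by positivity),
          add_sub_cancel_right, ofReal_integral_eq_lintegral_ofReal hi]
        filter_upwards [self_mem_ae_restrict measurableSet_Ioi] with u hu
        have : 0 < u := hu
        positivity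

lemma sq_lintegral_le_measure_mul {X : Type*} [MeasurableSpace X] {μ : Measure X} {s : Set X}
    (hs : MeasurableSet s) {f : X → ℝ≥0∞} (hf : Measurable f) (h0 : ∀ x ∉ s, f x = 0) :
    (∫⁻ x, f x ∂μ) ^ 2 ≤ μ s * ∫⁻ x, f x ^ 2 ∂μ := by
  have := ENNReal.lintegral_mul_le_Lp_mul_Lq μ Real.HolderConjugate.two_two
      (f := s.indicator 1) (measurable_one.indicator hs).aemeasurable hf.aemeasurable
  have e1 : s.indicator 1 * f = f := by
    ext x
    by_cases hx : x ∈ s <;> simp [hx, h0]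
  have e2 : ∀ x, s.indicator (1 : X → ℝ≥0∞) x ^ (2 : ℝ) = s.indicator 1 x := by
    intro x
    by_cases hx : x ∈ s <;> simp [hx]
  simp only [e1, e2, lintegral_indicator_one hs] at this
  refine (pow_le_pow_left' this 2).trans_eq ?_
  rw [mul_pow, ← ENNReal.rpow_natCast, ← ENNReal.rpow_natCast, ← ENNReal.rpow_mul,
    ← ENNReal.rpow_mul]
  simp

lemma volume_pos_of_lintegral_charFun_sq_lt_top {σ : Measure ℝ} [IsFiniteMeasure σ]
    (hσ : σ ≠ 0) (h : ∫⁻ ξ, ‖charFun σ ξ‖ₑ ^ 2 < ∞) {S : Set ℝ} (hS : IsCompact S)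
    (hσS : σ Sᶜ = 0) : 0 < volume S := by
  rw [pos_iff_ne_zero]
  intro hS0
  set J := ∫⁻ ξ, ‖charFun σ ξ‖ₑ ^ 2
  set M := σ Set.univ
  have hM : M ≠ 0 := by simpa [M] using hσ
  have hMt : M ≠ ∞ := measure_ne_top _ _
  -- the pairs of points at distance at most `2 δ`
  have hpairs : ∀ δ : ℝ, 0 < δ → ∫⁻ x, σ (Metric.closedBall x (2 * δ)) ∂σ ≤
      ENNReal.ofReal (Real.exp 1) * (ENNReal.ofReal δ * J) := by
    intro δ hδ
    have hG := lintegral_charFun_sq_mul_gaussian σ (b := δ ^ 2) (by positivity)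
    have h1 : ∫⁻ x, ∫⁻ y, ENNReal.ofReal (Real.exp (-‖x - y‖ ^ 2 / (4 * δ ^ 2))) ∂σ ∂σ ≤
        ENNReal.ofReal δ * J := by
      have hc : 1 ≤ ENNReal.ofReal δ * ENNReal.ofReal
          ((Real.pi / δ ^ 2) ^ (Module.finrank ℝ ℝ / 2 : ℝ)) := by
        rw [← ENNReal.ofReal_mul hδ.le, ENNReal.one_le_ofReal, Module.finrank_self, Nat.cast_one,
          ← Real.sqrt_eq_rpow, Real.sqrt_div Real.pi_pos.le, Real.sqrt_sq hδ.le,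
          mul_div_cancel₀ _ hδ.ne', Real.one_le_sqrt]
        linarith [Real.pi_gt_three]
      refine (le_mul_of_one_le_left' hc).trans ?_
      rw [mul_assoc, ← hG]
      gcongr
      refine lintegral_mono fun w => mul_le_of_le_one_right' ?_
      rw [ENNReal.ofReal_le_one, Real.exp_le_one_iff]
      nlinarith [sq_nonneg (δ * ‖w‖)]
    refine le_trans ?_ (mul_le_mul_right h1 _)
    rw [← lintegral_const_mul' _ _ ENNReal.ofReal_ne_top]
    refine lintegral_mono fun x => ?_
    rw [← lintegral_const_mul' _ _ ENNReal.ofReal_ne_top,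
      ← lintegral_indicator_one Metric.isClosed_closedBall.measurableSet]
    refine lintegral_mono fun y => ?_
    by_cases hy : y ∈ Metric.closedBall x (2 * δ)
    · rw [Set.indicator_of_mem hy, ← ENNReal.ofReal_mul (Real.exp_pos _).le, ← Real.exp_add,
        Pi.one_apply, ENNReal.one_le_ofReal, Real.one_le_exp_iff]
      rw [Metric.mem_closedBall, dist_comm, dist_eq_norm] at hy
      have : ‖x - y‖ ^ 2 ≤ 4 * δ ^ 2 := by nlinarith [norm_nonneg (x - y)]
      rw [neg_div]
      linarith [(div_le_one (by positivity)).2 this]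
    · rw [Set.indicator_of_notMem hy]
      exact zero_le
  have hmeas : ∀ δ : ℝ, Measurable fun u => σ (Metric.closedBall u δ) := by
    intro δ
    have : MeasurableSet {p : ℝ × ℝ | dist p.2 p.1 ≤ δ} :=
      measurableSet_le (by fun_prop) (by fun_prop)
    exact measurable_measure_prodMk_left this
  have hind : ∀ (δ u x : ℝ), (Metric.closedBall u δ).indicator (1 : ℝ → ℝ≥0∞) x =
      (Metric.closedBall x δ).indicator 1 u := by
    intro δ u x
    by_cases hx : x ∈ Metric.closedBall u δ
    · rw [Set.indicator_of_mem hx, Set.indicator_of_mem (Metric.mem_closedBall_comm.1 hx)]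
      rfl
    · rw [Set.indicator_of_notMem hx,
        Set.indicator_of_notMem (mt Metric.mem_closedBall_comm.1 hx)]
  have hindm : ∀ δ : ℝ, Measurable fun p : ℝ × ℝ =>
      (Metric.closedBall p.1 δ).indicator (1 : ℝ → ℝ≥0∞) p.2 := by
    intro δ
    have : MeasurableSet {p : ℝ × ℝ | dist p.2 p.1 ≤ δ} :=
      measurableSet_le (by fun_prop) (by fun_prop)
    exact measurable_one.indicator this
  have hball : ∀ δ u : ℝ, σ (Metric.closedBall u δ) =
      ∫⁻ x, (Metric.closedBall u δ).indicator 1 x ∂σ := fun δ u =>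
    (lintegral_indicator_one Metric.isClosed_closedBall.measurableSet).symm
  have hF1 : ∀ δ : ℝ, ∫⁻ u, σ (Metric.closedBall u δ) = ENNReal.ofReal (2 * δ) * M := by
    intro δ
    simp_rw [hball]
    rw [lintegral_lintegral_swap (hindm δ).aemeasurable]
    simp_rw [hind, lintegral_indicator_one Metric.isClosed_closedBall.measurableSet,
      Real.volume_closedBall, lintegral_const]
    rfl
  have hF2 : ∀ δ : ℝ, ∫⁻ u, σ (Metric.closedBall u δ) ^ 2 ≤
      ENNReal.ofReal (2 * δ) * ∫⁻ x, σ (Metric.closedBall x (2 * δ)) ∂σ := by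
    intro δ
    have hsq : ∀ u, σ (Metric.closedBall u δ) ^ 2 ≤
        ∫⁻ x, (Metric.closedBall u δ).indicator 1 x * σ (Metric.closedBall x (2 * δ)) ∂σ := by
      intro u
      rw [sq]
      nth_rewrite 1 [hball]
      rw [← lintegral_mul_const' _ _ (measure_ne_top _ _)]
      refine lintegral_mono fun x => ?_
      by_cases hx : x ∈ Metric.closedBall u δ
      · simp only [Set.indicator_of_mem hx, Pi.one_apply, one_mul]
        refine measure_mono (Metric.closedBall_subset_closedBall' ?_)
        rw [Metric.mem_closedBall, dist_comm] at hx
        linarith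
      · simp [hx]
    refine (lintegral_mono hsq).trans ?_
    rw [lintegral_lintegral_swap
      ((hindm δ).mul ((hmeas (2 * δ)).comp measurable_snd)).aemeasurable,
      ← lintegral_const_mul' _ _ ENNReal.ofReal_ne_top]
    refine lintegral_mono fun x => ?_
    rw [lintegral_mul_const' _ _ (measure_ne_top _ _)]
    simp_rw [hind, lintegral_indicator_one Metric.isClosed_closedBall.measurableSet,
      Real.volume_closedBall]
    rfl
  have hmain : ∀ δ : ℝ, 0 < δ → 4 * M ^ 2 ≤
      volume (Metric.cthickening δ S) * (2 * ENNReal.ofReal (Real.exp 1) * J) := by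
    intro δ hδ
    have hzero : ∀ u ∉ Metric.cthickening δ S, σ (Metric.closedBall u δ) = 0 := by
      intro u hu
      refine measure_mono_null (t := Sᶜ) (fun x hx (hxS : x ∈ S) => hu ?_) hσS
      rw [Metric.mem_closedBall, dist_comm] at hx
      exact Metric.mem_cthickening_of_dist_le u x δ S hxS hx
    have hcs := sq_lintegral_le_measure_mul (μ := volume)
      Metric.isClosed_cthickening.measurableSet (hmeas δ) hzero
    rw [hF1] at hcs
    have h2 := hcs.trans (mul_le_mul_right ((hF2 δ).trans
      (mul_le_mul_right (hpairs δ hδ) _)) _)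
    have hd : ENNReal.ofReal δ ≠ 0 := by simpa using hδ
    have hd2 : ENNReal.ofReal (2 * δ) = 2 * ENNReal.ofReal δ := by
      rw [ENNReal.ofReal_mul (by norm_num)]; simp
    rw [hd2] at h2
    have hdd : ENNReal.ofReal δ ^ 2 ≠ 0 := pow_ne_zero _ hd
    rw [← ENNReal.mul_le_mul_iff_right hdd (by simp)]
    calc _ = (2 * ENNReal.ofReal δ * M) ^ 2 := by ring
      _ ≤ _ := h2
      _ = _ := by ring
  have hlim := tendsto_measure_cthickening_of_isCompact (μ := volume) hS
  rw [hS0] at hlim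
  have hlim2 := ENNReal.Tendsto.mul_const (b := 2 * ENNReal.ofReal (Real.exp 1) * J) hlim
    (Or.inr (ENNReal.mul_ne_top (ENNReal.mul_ne_top (by simp) (by simp)) h.ne))
  rw [zero_mul] at hlim2
  have hlim3 := hlim2.mono_left (nhdsWithin_le_nhds (s := Set.Ioi 0))
  have := ge_of_tendsto hlim3 (b := 4 * M ^ 2)
    (by filter_upwards [self_mem_nhdsWithin] with δ hδ using hmain δ hδ)
  simp [hM] at this

lemma exists_lintegral_gaussian_mul_le {Y : Type*} [MeasurableSpace Y] {ν : Measure Y}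
    [IsFiniteMeasure ν] {g : Y → ℝ} (hg : Measurable g) {t : ℝ} (ht : 0 < t) {C : ℝ≥0∞}
    (hC : C ≠ ∞)
    (hν : ∀ v ρ : ℝ, 0 < ρ → ν {y | |g y - v| ≤ ρ} ≤ C * ENNReal.ofReal (ρ ^ t)) :
    ∃ C' : ℝ≥0∞, C' ≠ ∞ ∧ ∀ ξ a : ℝ, ENNReal.ofReal ((1 + ξ ^ 2) ^ (t / 2)) *
      ∫⁻ y, ENNReal.ofReal (Real.exp (-((a - ξ * g y) ^ 2 / 8))) ∂ν ≤ C' := by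
  refine ⟨ENNReal.ofReal (2 ^ (t / 2)) * ν Set.univ + ENNReal.ofReal (16 ^ (t / 2)) *
    (C * ENNReal.ofReal (Real.Gamma (t / 2 + 1))), ?_, fun ξ a => ?_⟩
  · exact ENNReal.add_ne_top.2 ⟨ENNReal.mul_ne_top (by simp) (measure_ne_top _ _),
      ENNReal.mul_ne_top (by simp) (ENNReal.mul_ne_top hC (by simp))⟩
  rcases le_or_gt |ξ| 1 with hξ | hξ
  · refine le_add_right (mul_le_mul' (ENNReal.ofReal_le_ofReal ?_) ?_)
    · refine Real.rpow_le_rpow (by positivity) ?_ (by positivity)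
      have := (sq_le_one_iff_abs_le_one ξ).2 hξ
      linarith
    · rw [← lintegral_one]
      refine lintegral_mono fun y => ?_
      rw [ENNReal.ofReal_le_one, Real.exp_le_one_iff]
      have : 0 ≤ (a - ξ * g y) ^ 2 / 8 := by positivity
      linarith
  · have hξ0 : 0 < |ξ| := by linarith
    have hξne : ξ ≠ 0 := abs_pos.1 hξ0
    refine le_add_left ?_
    have hlayer := lintegral_exp_neg_le_of_measure_le (σ := ν)
      (h := fun y => (a - ξ * g y) ^ 2 / 8) (by fun_prop) (fun y => by positivity)
      (p := t / 2) (by positivity) (C := C * ENNReal.ofReal (8 ^ (t / 2) / |ξ| ^ t)) (by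
        intro u hu
        have hsub : {y | (a - ξ * g y) ^ 2 / 8 ≤ u} ⊆
            {y | |g y - a / ξ| ≤ √(8 * u) / |ξ|} := by
          intro y (hy : (a - ξ * g y) ^ 2 / 8 ≤ u)
          have h1 : |g y - a / ξ| = |a - ξ * g y| / |ξ| := by
            rw [← abs_div, ← abs_neg]
            congr 1
            field_simp
            ring
          change |g y - a / ξ| ≤ √(8 * u) / |ξ|
          rw [h1]
          gcongr
          exact Real.abs_le_sqrt (by linarith)
        refine (measure_mono hsub).trans ((hν _ _ (by positivity)).trans_eq ?_)
        rw [mul_assoc, ← ENNReal.ofReal_mul (by positivity)]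
        congr 2
        rw [Real.div_rpow (by positivity) (by positivity), Real.sqrt_eq_rpow,
          ← Real.rpow_mul (by positivity), Real.mul_rpow (by positivity) hu.le]
        ring_nf)
    refine (mul_le_mul_right hlayer _).trans ?_
    rw [mul_right_comm C, ← mul_assoc, mul_comm (ENNReal.ofReal _) (_ * ENNReal.ofReal _),
      mul_comm (ENNReal.ofReal (16 ^ (t / 2)))]
    rw [mul_assoc, ← ENNReal.ofReal_mul (by positivity)]
    gcongr
    have h2 : (1 + ξ ^ 2) ^ (t / 2) ≤ 2 ^ (t / 2) * |ξ| ^ t := by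
      have : |ξ| ^ t = (ξ ^ 2) ^ (t / 2) := by
        rw [← sq_abs, ← Real.rpow_natCast, ← Real.rpow_mul hξ0.le]
        congr 1
        push_cast
        ring
      rw [this, ← Real.mul_rpow (by norm_num) (by positivity)]
      refine Real.rpow_le_rpow (by positivity) ?_ (by positivity)
      have : 1 ≤ ξ ^ 2 := by rw [← sq_abs]; nlinarith
      linarith
    calc (1 + ξ ^ 2) ^ (t / 2) * (8 ^ (t / 2) / |ξ| ^ t)
        ≤ 2 ^ (t / 2) * |ξ| ^ t * (8 ^ (t / 2) / |ξ| ^ t) := by gcongr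
      _ = 8 ^ (t / 2) * 2 ^ (t / 2) := by field_simp
      _ = 16 ^ (t / 2) := by
        rw [← Real.mul_rpow (by norm_num) (by norm_num)]
        norm_num

lemma rpow_mul_exp_neg_le {ι : Type*} [Fintype ι] {i j : ι} {w e : EuclideanSpace ℝ ι}
    {R t ξ : ℝ} (ht : 0 < t) (ht2 : t ≤ 2) (he : ‖e‖ ≤ R) (hei : e i = 1) :
    (1 + ‖w‖ ^ 2) ^ (t / 2) * Real.exp (-‖w - ξ • e‖ ^ 2 / 2) ≤
      4 * (2 * (1 + R ^ 2)) ^ (t / 2) * (Real.exp (-(1 / 8) * (w i - ξ) ^ 2) *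
        ((1 + ξ ^ 2) ^ (t / 2) * Real.exp (-((w j - ξ * e j) ^ 2 / 8)))) := by
  set h := ‖w - ξ • e‖
  have h0 : 0 ≤ h := norm_nonneg _
  have hw : ‖w‖ ≤ h + R * |ξ| := by
    calc ‖w‖ = ‖(w - ξ • e) + ξ • e‖ := by simp
      _ ≤ h + |ξ| * ‖e‖ := by
        refine (norm_add_le _ _).trans_eq ?_
        rw [norm_smul, Real.norm_eq_abs]
      _ ≤ h + R * |ξ| := by
        rw [mul_comm R]
        gcongr
  have hw2 : 1 + ‖w‖ ^ 2 ≤ 2 * (1 + R ^ 2) * (1 + ξ ^ 2) * (1 + h ^ 2) := by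
    have h1 : ‖w‖ ^ 2 ≤ (h + R * |ξ|) ^ 2 := by gcongr
    have h2 : (h + R * |ξ|) ^ 2 ≤ 2 * h ^ 2 + 2 * (R ^ 2 * ξ ^ 2) := by
      rw [← sq_abs ξ]
      nlinarith [sq_nonneg (h - R * |ξ|)]
    nlinarith [mul_nonneg (sq_nonneg R) (sq_nonneg h), mul_nonneg (sq_nonneg ξ) (sq_nonneg h),
      mul_nonneg (mul_nonneg (sq_nonneg R) (sq_nonneg ξ)) (sq_nonneg h), sq_nonneg R,
      sq_nonneg ξ, sq_nonneg h]
  have hpow : (1 + h ^ 2) ^ (t / 2) ≤ 4 * Real.exp (h ^ 2 / 4) := by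
    calc (1 + h ^ 2) ^ (t / 2) ≤ (1 + h ^ 2) ^ (1 : ℝ) :=
          Real.rpow_le_rpow_of_exponent_le (by nlinarith) (by linarith)
      _ ≤ _ := by
        rw [Real.rpow_one]
        nlinarith [Real.add_one_le_exp (h ^ 2 / 4)]
  have hcoord : ∀ k, (w k - ξ * e k) ^ 2 ≤ h ^ 2 := by
    intro k
    have := PiLp.norm_apply_le (w - ξ • e) k
    simp only [PiLp.sub_apply, PiLp.smul_apply, smul_eq_mul, Real.norm_eq_abs] at this
    rw [← sq_abs]
    gcongr
  have hi := hcoord i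
  have hj := hcoord j
  rw [hei, mul_one] at hi
  calc (1 + ‖w‖ ^ 2) ^ (t / 2) * Real.exp (-h ^ 2 / 2)
      ≤ (2 * (1 + R ^ 2) * (1 + ξ ^ 2) * (1 + h ^ 2)) ^ (t / 2) * Real.exp (-h ^ 2 / 2) := by
        gcongr
    _ = (2 * (1 + R ^ 2)) ^ (t / 2) * (1 + ξ ^ 2) ^ (t / 2) * (1 + h ^ 2) ^ (t / 2) *
        Real.exp (-h ^ 2 / 2) := by
        rw [Real.mul_rpow (by positivity) (by positivity),
          Real.mul_rpow (by positivity) (by positivity)]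
    _ ≤ (2 * (1 + R ^ 2)) ^ (t / 2) * (1 + ξ ^ 2) ^ (t / 2) * (4 * Real.exp (h ^ 2 / 4)) *
        Real.exp (-h ^ 2 / 2) := by gcongr
    _ = 4 * (2 * (1 + R ^ 2)) ^ (t / 2) * ((1 + ξ ^ 2) ^ (t / 2) * Real.exp (-(h ^ 2 / 4))) := by
        have : Real.exp (-(h ^ 2 / 4)) = Real.exp (h ^ 2 / 4) * Real.exp (-h ^ 2 / 2) := by
          rw [← Real.exp_add]
          ring_nf
        rw [this]
        ring
    _ ≤ 4 * (2 * (1 + R ^ 2)) ^ (t / 2) * ((1 + ξ ^ 2) ^ (t / 2) *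
        (Real.exp (-(1 / 8) * (w i - ξ) ^ 2) * Real.exp (-((w j - ξ * e j) ^ 2 / 8)))) := by
        rw [← Real.exp_add]
        gcongr
        linarith
    _ = _ := by ring

lemma exists_rpow_mul_lintegral_gaussian_le {ι : Type*} [Fintype ι] {i j : ι} {Y : Type*}
    [MeasurableSpace Y] {ν : Measure Y} [IsFiniteMeasure ν] {e : Y → EuclideanSpace ℝ ι}
    (he : Measurable e) {R : ℝ} (heR : ∀ y, ‖e y‖ ≤ R) (hei : ∀ y, e y i = 1)
    {t : ℝ} (ht : 0 < t) (ht2 : t ≤ 2) {C : ℝ≥0∞} (hC : C ≠ ∞)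
    (hν : ∀ v ρ : ℝ, 0 < ρ → ν {y | |e y j - v| ≤ ρ} ≤ C * ENNReal.ofReal (ρ ^ t)) :
    ∃ C' : ℝ≥0∞, C' ≠ ∞ ∧ ∀ w : EuclideanSpace ℝ ι,
      ENNReal.ofReal ((1 + ‖w‖ ^ 2) ^ (t / 2)) *
        ∫⁻ y, (∫⁻ ξ : ℝ, ENNReal.ofReal (Real.exp (-‖w - ξ • e y‖ ^ 2 / 2))) ∂ν ≤ C' := by
  have hg : Measurable fun y => e y j := by fun_prop
  obtain ⟨C₁, hC₁, h₁⟩ := exists_lintegral_gaussian_mul_le hg ht hC hν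
  set D : ℝ := 4 * (2 * (1 + R ^ 2)) ^ (t / 2)
  set G : ℝ≥0∞ := ∫⁻ ξ : ℝ, ENNReal.ofReal (Real.exp (-(1 / 8) * ‖ξ‖ ^ 2))
  have hG : G ≠ ∞ :=
    (integrable_exp_neg_mul_sq_norm (E := ℝ) (b := 1 / 8) (by norm_num)).lintegral_lt_top.ne
  refine ⟨ENNReal.ofReal D * (C₁ * G), ENNReal.mul_ne_top (by simp) (ENNReal.mul_ne_top hC₁ hG),
    fun w => ?_⟩
  have hpt : ∀ y (ξ : ℝ), ENNReal.ofReal ((1 + ‖w‖ ^ 2) ^ (t / 2)) *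
      ENNReal.ofReal (Real.exp (-‖w - ξ • e y‖ ^ 2 / 2)) ≤
      ENNReal.ofReal D * (ENNReal.ofReal (Real.exp (-(1 / 8) * (w i - ξ) ^ 2)) *
        (ENNReal.ofReal ((1 + ξ ^ 2) ^ (t / 2)) *
          ENNReal.ofReal (Real.exp (-((w j - ξ * e y j) ^ 2 / 8))))) := by
    intro y ξ
    rw [← ENNReal.ofReal_mul (by positivity), ← ENNReal.ofReal_mul (by positivity),
      ← ENNReal.ofReal_mul (by positivity), ← ENNReal.ofReal_mul (by positivity)]
    exact ENNReal.ofReal_le_ofReal (rpow_mul_exp_neg_le ht ht2 (heR y) (hei y))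
  rw [lintegral_lintegral_swap (by fun_prop),
    ← lintegral_const_mul' _ _ ENNReal.ofReal_ne_top]
  calc _ ≤ ∫⁻ ξ : ℝ, ENNReal.ofReal D * (ENNReal.ofReal (Real.exp (-(1 / 8) * (w i - ξ) ^ 2)) *
        (ENNReal.ofReal ((1 + ξ ^ 2) ^ (t / 2)) *
          ∫⁻ y, ENNReal.ofReal (Real.exp (-((w j - ξ * e y j) ^ 2 / 8))) ∂ν)) := by
        refine lintegral_mono fun ξ => ?_
        simp_rw [← lintegral_const_mul' _ _ ENNReal.ofReal_ne_top]
        exact lintegral_mono fun y => hpt y ξ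
    _ ≤ ∫⁻ ξ : ℝ, ENNReal.ofReal D *
        (ENNReal.ofReal (Real.exp (-(1 / 8) * (w i - ξ) ^ 2)) * C₁) := by
        gcongr with ξ
        exact h₁ ξ (w j)
    _ = _ := by
        rw [lintegral_const_mul' _ _ ENNReal.ofReal_ne_top, lintegral_mul_const' _ _ hC₁,
          mul_comm C₁, lintegral_sub_left_eq_self
            (fun ξ => ENNReal.ofReal (Real.exp (-(1 / 8) * ξ ^ 2))) (w i)]
        simp [G]

lemma lintegral_charFun_sq_mul_rpow_lt_top {E : Type*} [NormedAddCommGroup E]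
    [InnerProductSpace ℝ E] [FiniteDimensional ℝ E] [MeasurableSpace E] [BorelSpace E]
    {σ : Measure E} [IsFiniteMeasure σ] {s t : ℝ} (hs : 0 < s) (ht : 0 < t)
    (hst : (Module.finrank ℝ E : ℝ) < s + t) {C : ℝ≥0∞} (hC : C ≠ ∞)
    (hσ : ∀ x r, 0 < r → σ (Metric.closedBall x r) ≤ C * ENNReal.ofReal (r ^ s)) :
    ∫⁻ w, ‖charFun σ w‖ₑ ^ 2 * (ENNReal.ofReal ((1 + ‖w‖ ^ 2) ^ (t / 2)))⁻¹ < ∞ := by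
  set d : ℝ := (Module.finrank ℝ E : ℝ)
  have hGam : 0 < Real.Gamma (t / 2) := Real.Gamma_pos_of_pos (by positivity)
  -- the weight is a superposition of Gaussians
  have hweight : ∀ w : E, (ENNReal.ofReal ((1 + ‖w‖ ^ 2) ^ (t / 2)))⁻¹ =
      (ENNReal.ofReal (Real.Gamma (t / 2)))⁻¹ * ∫⁻ b in Set.Ioi 0,
        ENNReal.ofReal (b ^ (t / 2 - 1) * Real.exp (-b)) *
          ENNReal.ofReal (Real.exp (-b * ‖w‖ ^ 2)) := by
    intro w
    have hA : 0 < 1 + ‖w‖ ^ 2 := by positivity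
    have hint := Real.integral_rpow_mul_exp_neg_mul_Ioi (half_pos ht) hA
    have hi : IntegrableOn (fun b : ℝ => b ^ (t / 2 - 1) * Real.exp (-((1 + ‖w‖ ^ 2) * b)))
        (Set.Ioi 0) := by
      by_contra hcon
      rw [integral_undef hcon] at hint
      have : 0 < (1 / (1 + ‖w‖ ^ 2)) ^ (t / 2) * Real.Gamma (t / 2) := by positivity
      linarith
    have h2 : ∫⁻ b in Set.Ioi 0, ENNReal.ofReal (b ^ (t / 2 - 1) * Real.exp (-b)) *
          ENNReal.ofReal (Real.exp (-b * ‖w‖ ^ 2)) =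
        ENNReal.ofReal ((1 / (1 + ‖w‖ ^ 2)) ^ (t / 2) * Real.Gamma (t / 2)) := by
      rw [← hint, ofReal_integral_eq_lintegral_ofReal hi]
      · refine setLIntegral_congr_fun measurableSet_Ioi fun b hb => ?_
        have hb : 0 < b := hb
        rw [← ENNReal.ofReal_mul (by positivity), mul_assoc, ← Real.exp_add]
        ring_nf
      · filter_upwards [self_mem_ae_restrict measurableSet_Ioi] with b hb
        have hb : 0 < b := hb
        positivity
    rw [h2, ← ENNReal.ofReal_inv_of_pos hGam, ← ENNReal.ofReal_inv_of_pos (by positivity),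
      ← ENNReal.ofReal_mul (by positivity), one_div, Real.inv_rpow hA.le]
    congr 1
    field_simp
  have henergy : ∀ b : ℝ, 0 < b →
      ∫⁻ w, ‖charFun σ w‖ₑ ^ 2 * ENNReal.ofReal (Real.exp (-b * ‖w‖ ^ 2)) ≤
        ENNReal.ofReal ((Real.pi / b) ^ (d / 2)) * (C * ENNReal.ofReal ((4 * b) ^ (s / 2)) *
          ENNReal.ofReal (Real.Gamma (s / 2 + 1)) * σ Set.univ) := by
    intro b hb
    rw [lintegral_charFun_sq_mul_gaussian σ hb]
    gcongr
    rw [← lintegral_const]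
    refine lintegral_mono fun x => ?_
    have := lintegral_exp_neg_le_of_measure_le (σ := σ) (h := fun y => ‖x - y‖ ^ 2 / (4 * b))
      (by fun_prop) (fun y => by positivity) (p := s / 2) (by positivity)
      (C := C * ENNReal.ofReal ((4 * b) ^ (s / 2))) (by
        intro u hu
        have hsub : {y | ‖x - y‖ ^ 2 / (4 * b) ≤ u} ⊆ Metric.closedBall x √(4 * b * u) := by
          intro y (hy : ‖x - y‖ ^ 2 / (4 * b) ≤ u)
          rw [Metric.mem_closedBall, dist_comm, dist_eq_norm]
          refine Real.le_sqrt_of_sq_le ?_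
          rwa [div_le_iff₀' (by positivity)] at hy
        refine (measure_mono hsub).trans ((hσ _ _ (by positivity)).trans_eq ?_)
        rw [mul_assoc C, ← ENNReal.ofReal_mul (by positivity), Real.sqrt_eq_rpow,
          ← Real.rpow_mul (by positivity), ← Real.mul_rpow (by positivity) hu.le]
        ring_nf)
    simpa only [neg_div] using this
  have hmeas : Measurable fun w : E => ‖charFun σ w‖ₑ ^ 2 :=
    measurable_charFun.enorm.pow_const _
  set K : ℝ≥0∞ := C * ENNReal.ofReal (Real.Gamma (s / 2 + 1)) * σ Set.univ
  have hK : K ≠ ∞ := ENNReal.mul_ne_top (ENNReal.mul_ne_top hC (by simp)) (measure_ne_top _ _)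
  have hswap : ∫⁻ w, ‖charFun σ w‖ₑ ^ 2 * (ENNReal.ofReal ((1 + ‖w‖ ^ 2) ^ (t / 2)))⁻¹ =
      (ENNReal.ofReal (Real.Gamma (t / 2)))⁻¹ * ∫⁻ b in Set.Ioi 0,
        ENNReal.ofReal (b ^ (t / 2 - 1) * Real.exp (-b)) *
          ∫⁻ w, ‖charFun σ w‖ₑ ^ 2 * ENNReal.ofReal (Real.exp (-b * ‖w‖ ^ 2)) := by
    have hinv : (ENNReal.ofReal (Real.Gamma (t / 2)))⁻¹ ≠ ∞ := by simpa using hGam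
    simp_rw [hweight, ← lintegral_const_mul' _ _ ENNReal.ofReal_ne_top,
      mul_left_comm _ (ENNReal.ofReal (Real.Gamma (t / 2)))⁻¹]
    rw [lintegral_const_mul' _ _ hinv]
    congr 1
    rw [lintegral_lintegral_swap (by fun_prop)]
    refine lintegral_congr fun w => ?_
    rw [← lintegral_const_mul _ (by fun_prop)]
    refine lintegral_congr fun b => ?_
    ring
  rw [hswap]
  refine ENNReal.mul_lt_top (by simpa using hGam) ?_
  calc ∫⁻ b in Set.Ioi 0, ENNReal.ofReal (b ^ (t / 2 - 1) * Real.exp (-b)) *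
          ∫⁻ w, ‖charFun σ w‖ₑ ^ 2 * ENNReal.ofReal (Real.exp (-b * ‖w‖ ^ 2))
      ≤ ∫⁻ b in Set.Ioi 0, ENNReal.ofReal (Real.pi ^ (d / 2) * 4 ^ (s / 2)) * K *
          ENNReal.ofReal (Real.exp (-b) * b ^ ((s + t - d) / 2 - 1)) := by
        refine setLIntegral_mono (by fun_prop) fun b hb => ?_
        have hb : 0 < b := hb
        refine (mul_le_mul_right (henergy b hb) _).trans_eq ?_
        have hexp : b ^ (t / 2 - 1) * Real.exp (-b) * (Real.pi / b) ^ (d / 2) *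
            (4 * b) ^ (s / 2) = Real.pi ^ (d / 2) * 4 ^ (s / 2) *
              (Real.exp (-b) * b ^ ((s + t - d) / 2 - 1)) := by
          have : b ^ ((s + t - d) / 2 - 1) = b ^ (t / 2 - 1) / b ^ (d / 2) * b ^ (s / 2) := by
            rw [← Real.rpow_sub hb, ← Real.rpow_add hb]
            ring_nf
          rw [this, Real.div_rpow Real.pi_pos.le hb.le,
            Real.mul_rpow (by norm_num) hb.le]
          ring
        calc _ = ENNReal.ofReal (b ^ (t / 2 - 1) * Real.exp (-b)) *
            ENNReal.ofReal ((Real.pi / b) ^ (d / 2)) * ENNReal.ofReal ((4 * b) ^ (s / 2)) * K := by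
              ring
          _ = _ := by
            rw [← ENNReal.ofReal_mul (by positivity), ← ENNReal.ofReal_mul (by positivity), hexp,
              ENNReal.ofReal_mul (by positivity)]
            ring
    _ < ∞ := by
        rw [lintegral_const_mul _ (by fun_prop)]
        refine ENNReal.mul_lt_top (ENNReal.mul_lt_top (by simp) hK.lt_top) ?_
        exact (Real.GammaIntegral_convergent (s := (s + t - d) / 2) (by linarith)).lintegral_lt_top

lemma lintegral_charFun_smul_sq_lt_top {ι : Type*} [Fintype ι] {i j : ι} {Y : Type*}
    [MeasurableSpace Y] {ν : Measure Y} [IsFiniteMeasure ν] {e : Y → EuclideanSpace ℝ ι}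
    (he : Measurable e) {R : ℝ} (heR : ∀ y, ‖e y‖ ≤ R) (hei : ∀ y, e y i = 1)
    {s t : ℝ} (hs : 0 < s) (ht : 0 < t) (ht2 : t ≤ 2) (hst : (Fintype.card ι : ℝ) < s + t)
    {C : ℝ≥0∞} (hC : C ≠ ∞)
    (hν : ∀ v ρ : ℝ, 0 < ρ → ν {y | |e y j - v| ≤ ρ} ≤ C * ENNReal.ofReal (ρ ^ t))
    {σ : Measure (EuclideanSpace ℝ ι)} [IsFiniteMeasure σ] {C' : ℝ≥0∞} (hC' : C' ≠ ∞)
    (hσ : ∀ x r, 0 < r → σ (Metric.closedBall x r) ≤ C' * ENNReal.ofReal (r ^ s)) :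
    ∫⁻ y, (∫⁻ ξ : ℝ, ‖charFun (σ.withDensity fun x => ENNReal.ofReal (Real.exp (-‖x‖ ^ 2 / 2)))
      (ξ • e y)‖ₑ ^ 2) ∂ν < ∞ := by
  obtain ⟨C₁, hC₁, h₁⟩ := enorm_sq_charFun_withDensity_gaussian_le σ
  obtain ⟨C₂, hC₂, h₂⟩ := exists_rpow_mul_lintegral_gaussian_le he heR hei ht ht2 hC hν
  have h₃ := lintegral_charFun_sq_mul_rpow_lt_top hs ht (by simpa using hst) hC' hσ
  have hmeas : Measurable fun w => ‖charFun σ w‖ₑ ^ 2 := measurable_charFun.enorm.pow_const _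
  calc _ ≤ ∫⁻ y, (∫⁻ ξ : ℝ, C₁ * ∫⁻ w, ‖charFun σ w‖ₑ ^ 2 *
        ENNReal.ofReal (Real.exp (-‖w - ξ • e y‖ ^ 2 / 2))) ∂ν := by
        gcongr with y ξ
        exact h₁ _
    _ = C₁ * ∫⁻ w, ‖charFun σ w‖ₑ ^ 2 *
        ∫⁻ y, (∫⁻ ξ : ℝ, ENNReal.ofReal (Real.exp (-‖w - ξ • e y‖ ^ 2 / 2))) ∂ν := by
        simp_rw [lintegral_const_mul' _ _ hC₁]
        congr 1
        have h4 : ∀ y, ∫⁻ ξ : ℝ, ∫⁻ w, ‖charFun σ w‖ₑ ^ 2 *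
            ENNReal.ofReal (Real.exp (-‖w - ξ • e y‖ ^ 2 / 2)) =
            ∫⁻ w, ‖charFun σ w‖ₑ ^ 2 *
              ∫⁻ ξ : ℝ, ENNReal.ofReal (Real.exp (-‖w - ξ • e y‖ ^ 2 / 2)) := by
          intro y
          rw [lintegral_lintegral_swap (by fun_prop)]
          refine lintegral_congr fun w => ?_
          rw [lintegral_const_mul _ (by fun_prop)]
        simp_rw [h4]
        have hm2 : Measurable fun p : Y × EuclideanSpace ℝ ι =>
            ∫⁻ ξ : ℝ, ENNReal.ofReal (Real.exp (-‖p.2 - ξ • e p.1‖ ^ 2 / 2)) :=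
          Measurable.lintegral_prod_right' (f := fun q : (Y × EuclideanSpace ℝ ι) × ℝ =>
            ENNReal.ofReal (Real.exp (-‖q.1.2 - q.2 • e q.1.1‖ ^ 2 / 2))) (by fun_prop)
        rw [lintegral_lintegral_swap ((hmeas.comp measurable_snd).mul hm2).aemeasurable]
        refine lintegral_congr fun w => ?_
        rw [lintegral_const_mul' _ _ (by simp)]
    _ ≤ C₁ * ∫⁻ w, ‖charFun σ w‖ₑ ^ 2 *
        (C₂ * (ENNReal.ofReal ((1 + ‖w‖ ^ 2) ^ (t / 2)))⁻¹) := by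
        gcongr with w
        rw [← div_eq_mul_inv, ENNReal.le_div_iff_mul_le (Or.inl _) (Or.inl ENNReal.ofReal_ne_top),
          mul_comm]
        · exact h₂ w
        · have : 0 < (1 + ‖w‖ ^ 2) ^ (t / 2) := by positivity
          simpa using this
    _ < ∞ := by
        simp_rw [mul_left_comm _ C₂]
        rw [lintegral_const_mul' _ _ hC₂]
        exact ENNReal.mul_lt_top hC₁.lt_top (ENNReal.mul_lt_top hC₂.lt_top h₃)

lemma exists_outerMeasure_le_ediam_rpow {X : Type*} [EMetricSpace X] [MeasurableSpace X]
    [BorelSpace X] {s : ℝ} (hs : 0 < s) (h : Measure.hausdorffMeasure s (Set.univ : Set X) ≠ 0) :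
    ∃ c : OuterMeasure X, c Set.univ ≠ 0 ∧ ∀ S, c S ≤ Metric.ediam S ^ s := by
  refine ⟨OuterMeasure.ofFunction (fun S => Metric.ediam S ^ s) (by simp [hs]), ?_,
    fun S => OuterMeasure.ofFunction_le S⟩
  contrapose! h
  rw [Measure.hausdorffMeasure_apply, ← nonpos_iff_eq_zero]
  refine iSup₂_le fun r hr => le_of_forall_gt fun ε hε => ?_
  have hlt : (0 : ℝ≥0∞) < min ε (r ^ s) :=
    lt_min hε (ENNReal.rpow_pos_of_nonneg hr hs.le)
  rw [← h, OuterMeasure.ofFunction_apply] at hlt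
  simp only [iInf_lt_iff] at hlt
  obtain ⟨t, ht, hsum⟩ := hlt
  refine ((iInf_le _ t).trans <| (iInf_le _ ht).trans <|
    (iInf_le _ (fun k => ?_)).trans ?_).trans_lt (hsum.trans_le (min_le_left _ _))
  · rw [← ENNReal.rpow_le_rpow_iff hs]
    exact (ENNReal.le_tsum k).trans (hsum.le.trans (min_le_right _ _))
  · exact ENNReal.tsum_le_tsum fun k => iSup_le fun _ => le_rfl

lemma exists_le_tsum_fiber_eq {J : Type*} (par : J → J) {l w : J → ℝ≥0∞}
    (h : ∀ p, l p ≤ ∑' q, (par ⁻¹' {p}).indicator w q)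
    (hfin : ∀ p, ∑' q, (par ⁻¹' {p}).indicator w q ≠ ∞) :
    ∃ l' : J → ℝ≥0∞, (∀ q, l' q ≤ w q) ∧ ∀ p, ∑' q, (par ⁻¹' {p}).indicator l' q = l p := by
  set D : J → ℝ≥0∞ := fun p => ∑' q, (par ⁻¹' {p}).indicator w q
  refine ⟨fun q => w q * (l (par q) / D (par q)), fun q => ?_, fun p => ?_⟩
  · exact mul_le_of_le_one_right' (ENNReal.div_le_of_le_mul (by simpa using h (par q)))
  · have : ∀ q, (par ⁻¹' {p}).indicator (fun q => w q * (l (par q) / D (par q))) q =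
        (par ⁻¹' {p}).indicator w q * (l p / D p) := by
      intro q
      by_cases hq : par q = p <;> simp [Set.indicator, hq]
    simp_rw [this]
    rw [ENNReal.tsum_mul_right]
    refine ENNReal.mul_div_cancel' (fun h0 => ?_) fun h0 => absurd h0 (hfin p)
    exact le_antisymm ((h p).trans_eq h0) zero_le

lemma exists_measure_map_eq {J : Type*} [Countable J] [MeasurableSpace J]
    [MeasurableSingletonClass J] (par : J → J) {l : Measure J} {w : J → ℝ≥0∞}
    (h : ∀ p, l {p} ≤ ∑' q, (par ⁻¹' {p}).indicator w q)
    (hfin : ∀ p, ∑' q, (par ⁻¹' {p}).indicator w q ≠ ∞) :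
    ∃ l' : Measure J, (∀ q, l' {q} ≤ w q) ∧ l'.map par = l := by
  obtain ⟨m, hm, hsum⟩ := exists_le_tsum_fiber_eq par h hfin
  refine ⟨Measure.sum fun q => m q • Measure.dirac q, fun q => ?_, ?_⟩
  · rw [Measure.sum_smul_dirac_singleton]
    exact hm q
  · refine Measure.ext_of_singleton fun p => ?_
    rw [Measure.map_apply (measurable_of_countable _) (measurableSet_singleton p),
      Measure.sum_apply _ (Set.to_countable _).measurableSet, ← hsum p]
    refine tsum_congr fun q => ?_
    by_cases hq : par q = p <;> simp [Set.indicator, hq]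

lemma exists_seq_measure_map_eq {X J : Type*} [Countable J] [MeasurableSpace J]
    [MeasurableSingletonClass J] {par : J → J} {Q : ℕ → X → J}
    (hQ : ∀ k x, par (Q (k + 1) x) = Q k x) (hfin : ∀ k, (Set.range (Q k)).Finite)
    (c : OuterMeasure X) (hc : c Set.univ ≠ ∞) :
    ∃ l : ℕ → Measure J, (∀ k q, l k {q} ≤ c (Q k ⁻¹' {q})) ∧
      (∀ k, (l (k + 1)).map par = l k) ∧ c Set.univ ≤ l 0 Set.univ ∧ l 0 Set.univ ≠ ∞ := by
  have hsub : ∀ k, Function.support (fun q => c (Q k ⁻¹' {q})) ⊆ Set.range (Q k) := by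
    intro k q hq
    by_contra hqr
    refine hq ?_
    have : Q k ⁻¹' {q} = ∅ := by
      rw [Set.preimage_singleton_eq_empty]
      exact hqr
    simp [this]
  have htsum : ∀ k, ∑' q, c (Q k ⁻¹' {q}) ≠ ∞ := by
    intro k
    rw [tsum_eq_sum' (s := (hfin k).toFinset) (by simpa using hsub k)]
    exact ENNReal.sum_ne_top.2 fun q _ => ne_top_of_le_ne_top hc (measure_mono (Set.subset_univ _))
  have hstep : ∀ k (l : Measure J), (∀ q, l {q} ≤ c (Q k ⁻¹' {q})) →
      ∃ l' : Measure J, (∀ q, l' {q} ≤ c (Q (k + 1) ⁻¹' {q})) ∧ l'.map par = l := by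
    intro k l hl
    refine exists_measure_map_eq par (fun p => (hl p).trans ?_) fun p =>
      ne_top_of_le_ne_top (htsum (k + 1)) (ENNReal.tsum_le_tsum fun q =>
        Set.indicator_le_self _ _ _)
    rw [← tsum_subtype]
    refine (measure_mono ?_).trans (measure_iUnion_le _)
    intro x hx
    exact Set.mem_iUnion.2 ⟨⟨Q (k + 1) x, (hQ k x).trans hx⟩, rfl⟩
  choose next hnext hmap using hstep
  let l0 : Measure J := Measure.sum fun q => c (Q 0 ⁻¹' {q}) • Measure.dirac q
  have hl0 : ∀ q, l0 {q} ≤ c (Q 0 ⁻¹' {q}) := fun q =>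
    (Measure.sum_smul_dirac_singleton (f := fun q => c (Q 0 ⁻¹' {q}))).le
  have hl0univ : l0 Set.univ = ∑' q, c (Q 0 ⁻¹' {q}) := by
    simp [l0, Measure.sum_apply _ MeasurableSet.univ]
  let F : ∀ k, {l : Measure J // ∀ q, l {q} ≤ c (Q k ⁻¹' {q})} := fun k =>
    Nat.rec ⟨l0, hl0⟩ (fun k l => ⟨next k l.1 l.2, hnext k l.1 l.2⟩) k
  refine ⟨fun k => (F k).1, fun k => (F k).2, fun k => hmap k _ _, ?_, ?_⟩
  · change _ ≤ l0 Set.univ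
    rw [hl0univ]
    refine (measure_mono ?_).trans (measure_iUnion_le _)
    intro x _
    exact Set.mem_iUnion.2 ⟨Q 0 x, rfl⟩
  · change l0 Set.univ ≠ ∞
    rw [hl0univ]
    exact htsum 0

lemma floor_two_pow_succ_mul_ediv_two (k : ℕ) (a : ℝ) : ⌊2 ^ (k + 1) * a⌋ / 2 = ⌊2 ^ k * a⌋ := by
  have h := Int.floor_div_natCast (2 ^ (k + 1) * a) 2
  rw [← Nat.cast_ofNat (R := ℤ), ← h]
  congr 1
  push_cast
  ring

lemma exists_seq_probabilityMeasure_ball_le {X ι : Type*} [Fintype ι] [MetricSpace X]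
    [CompactSpace X] [MeasurableSpace X] [BorelSpace X] {φ : X → ι → ℝ} (hφ : LipschitzWith 1 φ)
    {L : NNReal} (hL : AntilipschitzWith L φ) {s : ℝ} (hs : 0 < s)
    (h : Measure.hausdorffMeasure s (Set.univ : Set X) ≠ 0) :
    ∃ μ : ℕ → ProbabilityMeasure X, ∃ C : ℝ≥0∞, C ≠ ∞ ∧ ∀ x j k, j ≤ k →
      (μ k : Measure X) (Metric.ball x ((1 / 2) ^ j)) ≤
        C * ENNReal.ofReal (((1 / 2) ^ j : ℝ) ^ s) := by
  classical
  obtain ⟨c, hc0, hcs⟩ := exists_outerMeasure_le_ediam_rpow hs h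
  have hcfin : c Set.univ ≠ ∞ := ne_top_of_le_ne_top
    (ENNReal.rpow_ne_top_of_nonneg hs.le (isCompact_univ.isBounded.ediam_ne_top)) (hcs _)
  have : Nonempty X := by
    by_contra hX
    rw [not_nonempty_iff] at hX
    exact hc0 (by simp [Set.univ_eq_empty_iff.2 hX])
  set Q : ℕ → X → ι → ℤ := fun k x i => ⌊2 ^ k * φ x i⌋
  set par : (ι → ℤ) → ι → ℤ := fun q i => q i / 2
  have hQ : ∀ k x, par (Q (k + 1) x) = Q k x := fun k x =>
    funext fun i => floor_two_pow_succ_mul_ediv_two k (φ x i)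
  obtain ⟨R, hR⟩ : ∃ R : ℝ, ∀ x i, |φ x i| ≤ R := by
    obtain ⟨R, hR⟩ := (isCompact_range hφ.continuous).isBounded.exists_norm_le
    exact ⟨R, fun x i => (norm_le_pi_norm (φ x) i).trans (hR _ ⟨x, rfl⟩)⟩
  have hfin : ∀ k, (Set.range (Q k)).Finite := by
    intro k
    refine (Set.finite_Icc (fun _ : ι => ⌊-(2 ^ k * R)⌋) (fun _ => ⌊2 ^ k * R⌋)).subset ?_
    rintro _ ⟨x, rfl⟩
    have h2 : (0 : ℝ) < 2 ^ k := by positivity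
    refine ⟨fun i => Int.floor_le_floor ?_, fun i => Int.floor_le_floor ?_⟩
    · nlinarith [(abs_le.1 (hR x i)).1]
    · nlinarith [(abs_le.1 (hR x i)).2]
  obtain ⟨l, hl, hmap, hl0, hlfin⟩ := exists_seq_measure_map_eq hQ hfin c hcfin
  have hpar : Measurable par := measurable_of_countable _
  have hiter : ∀ j m, (l (j + m)).map par^[m] = l j := by
    intro j m
    induction m with
    | zero => simp
    | succ m ih =>
      rw [Function.iterate_succ, ← Measure.map_map (hpar.iterate m) hpar, ← add_assoc, hmap, ih]
  have hQiter : ∀ j m x, par^[m] (Q (j + m) x) = Q j x := by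
    intro j m x
    induction m with
    | zero => rfl
    | succ m ih => rw [Function.iterate_succ_apply, ← add_assoc, hQ, ih]
  set M := l 0 Set.univ
  have hM0 : M ≠ 0 := fun h0 => hc0 (le_antisymm (hl0.trans_eq h0) zero_le)
  have hmass : ∀ k, l k Set.univ = M := by
    intro k
    have := hiter 0 k
    rw [zero_add] at this
    simp only [M, ← this]
    rw [Measure.map_apply (hpar.iterate k) MeasurableSet.univ, Set.preimage_univ]
  choose! ψ hψ using fun (k : ℕ) (q : ι → ℤ) (hq : q ∈ Set.range (Q k)) => hq
  have hψm : ∀ k, Measurable (ψ k) := fun k => measurable_of_countable _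
  have hnull : ∀ k, l k (Set.range (Q k))ᶜ = 0 := by
    intro k
    rw [measure_null_iff_singleton (Set.to_countable _)]
    intro q hq
    refine le_antisymm ((hl k q).trans_eq ?_) zero_le
    rw [Set.preimage_singleton_eq_empty.2 hq, measure_empty]
  have hediam : ∀ j q, Metric.ediam (Q j ⁻¹' {q}) ≤ L * ENNReal.ofReal ((1 / 2) ^ j) := by
    intro j q
    refine Metric.ediam_le fun x hx y hy => (hL x y).trans ?_
    gcongr
    rw [edist_dist]
    refine ENNReal.ofReal_le_ofReal ((dist_pi_le_iff (by positivity)).2 fun i => ?_)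
    have hxy : Q j x i = Q j y i := by rw [hx, hy]
    have := (Int.abs_sub_lt_one_of_floor_eq_floor hxy).le
    rw [← mul_sub, abs_mul, abs_of_pos (by positivity)] at this
    rw [Real.dist_eq, one_div, inv_pow]
    exact (le_inv_mul_iff₀ (by positivity)).2 this |>.trans_eq (mul_one _)
  have hprob : ∀ k, IsProbabilityMeasure (M⁻¹ • (l k).map (ψ k)) := fun k => ⟨by
    rw [Measure.smul_apply, Measure.map_apply (hψm k) MeasurableSet.univ, Set.preimage_univ,
      hmass, smul_eq_mul, ENNReal.inv_mul_cancel hM0 hlfin]⟩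
  refine ⟨fun k => ⟨_, hprob k⟩, M⁻¹ * (3 ^ Fintype.card ι * (L : ℝ≥0∞) ^ s), ?_, ?_⟩
  · exact ENNReal.mul_ne_top (ENNReal.inv_ne_top.2 hM0) (ENNReal.mul_ne_top (by simp)
      (ENNReal.rpow_ne_top_of_nonneg hs.le ENNReal.coe_ne_top))
  intro x j k hjk
  obtain ⟨m, rfl⟩ := Nat.exists_eq_add_of_le hjk
  set T : Finset (ι → ℤ) := Fintype.piFinset fun i => Finset.Icc (Q j x i - 1) (Q j x i + 1)
  have hT : T.card = 3 ^ Fintype.card ι := by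
    simp only [T, Fintype.card_piFinset, Int.card_Icc]
    have : ∀ i, (Q j x i + 1 + 1 - (Q j x i - 1)).toNat = 3 := fun i => by omega
    simp [this]
  have hball : ∀ y ∈ Metric.ball x ((1 / 2 : ℝ) ^ j), Q j y ∈ T := by
    intro y hy
    rw [Fintype.mem_piFinset]
    intro i
    have hd : |φ y i - φ x i| < (1 / 2 : ℝ) ^ j :=
      ((dist_le_pi_dist (φ y) (φ x) i).trans (by simpa using hφ.dist_le_mul y x)).trans_lt hy
    have hd' : |2 ^ j * φ y i - 2 ^ j * φ x i| < 1 := by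
      rw [← mul_sub, abs_mul, abs_of_pos (by positivity)]
      calc 2 ^ j * |φ y i - φ x i| < 2 ^ j * (1 / 2) ^ j := by gcongr
        _ = 1 := by rw [← mul_pow]; norm_num
    obtain ⟨h1, h2⟩ := abs_lt.1 hd'
    rw [Finset.mem_Icc]
    constructor
    · rw [sub_le_iff_le_add, ← Int.floor_add_one]
      exact Int.floor_le_floor (by linarith)
    · rw [← Int.floor_add_one]
      exact Int.floor_le_floor (by linarith)
  change (M⁻¹ • (l (j + m)).map (ψ (j + m))) (Metric.ball x ((1 / 2) ^ j)) ≤ _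
  rw [Measure.smul_apply, smul_eq_mul, mul_assoc]
  gcongr
  rw [Measure.map_apply (hψm _) Metric.isOpen_ball.measurableSet]
  have hsub : ψ (j + m) ⁻¹' Metric.ball x ((1 / 2) ^ j) ⊆
      (Set.range (Q (j + m)))ᶜ ∪ par^[m] ⁻¹' T := by
    intro q hq
    by_cases hqr : q ∈ Set.range (Q (j + m))
    · right
      have := hball _ hq
      rw [← hQiter j m, hψ _ _ hqr] at this
      exact this
    · exact Or.inl hqr
  calc _ ≤ l (j + m) (par^[m] ⁻¹' T) := by
        refine (measure_mono hsub).trans ((measure_union_le _ _).trans_eq ?_)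
        rw [hnull, zero_add]
    _ = l j T := by
        rw [← hiter j m, Measure.map_apply (hpar.iterate m) (Set.to_countable _).measurableSet]
    _ = ∑ q ∈ T, l j {q} := (sum_measure_singleton).symm
    _ ≤ ∑ q ∈ T, (L * ENNReal.ofReal ((1 / 2) ^ j)) ^ s := by
        gcongr with q
        refine ((hl j q).trans (hcs _)).trans ?_
        gcongr
        exact hediam j q
    _ = _ := by
        rw [Finset.sum_const, hT, ENNReal.mul_rpow_of_nonneg _ _ hs.le,
          ENNReal.ofReal_rpow_of_pos (by positivity), nsmul_eq_mul, ← mul_assoc]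
        simp

lemma exists_isProbabilityMeasure_closedBall_le {X ι : Type*} [Fintype ι] [MetricSpace X]
    [CompactSpace X] [MeasurableSpace X] [BorelSpace X] {φ : X → ι → ℝ} (hφ : LipschitzWith 1 φ)
    {L : NNReal} (hL : AntilipschitzWith L φ) {s : ℝ} (hs : 0 < s)
    (h : Measure.hausdorffMeasure s (Set.univ : Set X) ≠ 0) :
    ∃ μ : Measure X, IsProbabilityMeasure μ ∧ ∃ C : ℝ≥0∞, C ≠ ∞ ∧ ∀ x r, 0 < r →
      μ (Metric.closedBall x r) ≤ C * ENNReal.ofReal (r ^ s) := by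
  obtain ⟨μ, C, hC, hμ⟩ := exists_seq_probabilityMeasure_ball_le hφ hL hs h
  set F : Ultrafilter (ProbabilityMeasure X) := (Filter.hyperfilter ℕ).map μ
  have hlim : Filter.Tendsto μ (Filter.hyperfilter ℕ) (nhds F.lim) := F.le_nhds_lim
  refine ⟨F.lim, inferInstance, (C + 1) * ENNReal.ofReal (4 ^ s),
    ENNReal.mul_ne_top (by simp [hC]) (by simp), fun x r hr => ?_⟩
  have h4 : (C + 1) * ENNReal.ofReal (4 ^ s) * ENNReal.ofReal (r ^ s) =
      (C + 1) * ENNReal.ofReal ((4 * r) ^ s) := by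
    rw [mul_assoc, ← ENNReal.ofReal_mul (by positivity), ← Real.mul_rpow (by norm_num) hr.le]
  rw [h4]
  rcases le_or_gt (2 * r) 1 with hr1 | hr1
  · obtain ⟨j, hj, hj'⟩ := exists_nat_pow_near_of_lt_one (y := (1 / 2 : ℝ)) (by positivity) hr1
      (by norm_num) (by norm_num)
    calc (F.lim : Measure X) (Metric.closedBall x r)
        ≤ (F.lim : Measure X) (Metric.ball x ((1 / 2) ^ j)) :=
          measure_mono (Metric.closedBall_subset_ball (by linarith))
      _ ≤ _ := ProbabilityMeasure.le_liminf_measure_open_of_tendsto hlim Metric.isOpen_ball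
      _ ≤ C * ENNReal.ofReal (((1 / 2) ^ j : ℝ) ^ s) := by
          refine Filter.liminf_le_of_frequently_le' (Filter.Eventually.frequently ?_)
          exact Nat.hyperfilter_le_atTop ((Filter.eventually_ge_atTop j).mono
            fun k hk => hμ x j k hk)
      _ ≤ _ := by
          rw [pow_succ] at hj
          gcongr
          · exact le_self_add
          · linarith
  · calc (F.lim : Measure X) (Metric.closedBall x r) ≤ 1 * 1 := by simpa using prob_le_one
      _ ≤ _ := by
          gcongr
          · exact le_add_self
          · rw [ENNReal.one_le_ofReal]
            exact Real.one_le_rpow (by linarith) hs.le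

lemma HasStrictFDerivAt.exists_antilipschitzWith_domRestrict {E F : Type*}
    [NormedAddCommGroup E] [NormedSpace ℝ E] [NormedAddCommGroup F] [NormedSpace ℝ F] {f : E → F}
    {f' : E ≃L[ℝ] F} {x : E} (hf : HasStrictFDerivAt f (f' : E →L[ℝ] F) x) :
    ∃ u ∈ nhds x, ∃ N : NNReal, AntilipschitzWith N (u.domRestrict f) := by
  obtain ⟨u, hxu, hu, happ⟩ := hf.approximates_deriv_on_open_nhds
  refine ⟨u, hu.mem_nhds hxu, _, happ.antilipschitz ?_⟩
  refine f'.subsingleton_or_nnnorm_symm_pos.imp id fun h => ?_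
  exact NNReal.half_lt_self (inv_ne_zero h.ne')

lemma AntilipschitzWith.measure_preimage_closedBall_le {X Z : Type*} [PseudoMetricSpace X]
    [MeasurableSpace X] [PseudoMetricSpace Z] {f : X → Z} {N : NNReal} (hf : AntilipschitzWith N f)
    {μ : Measure X} {C : ℝ≥0∞} {s : ℝ}
    (hμ : ∀ x r, 0 < r → μ (Metric.closedBall x r) ≤ C * ENNReal.ofReal (r ^ s))
    (z : Z) {r : ℝ} (hr : 0 < r) :
    μ (f ⁻¹' Metric.closedBall z r) ≤
      C * ENNReal.ofReal ((2 * N + 1) ^ s) * ENNReal.ofReal (r ^ s) := by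
  rcases (f ⁻¹' Metric.closedBall z r).eq_empty_or_nonempty with h | ⟨x, hx⟩
  · simp [h]
  have hsub : f ⁻¹' Metric.closedBall z r ⊆ Metric.closedBall x ((2 * N + 1) * r) := by
    intro y hy
    have h1 : dist (f y) z ≤ r := hy
    have h2 : dist (f x) z ≤ r := hx
    have h3 := hf.le_mul_dist y x
    have h4 : dist (f y) (f x) ≤ 2 * r := by
      linarith [dist_triangle_right (f y) (f x) z]
    have : (N : ℝ) * dist (f y) (f x) ≤ N * (2 * r) := by gcongr
    rw [Metric.mem_closedBall]
    linarith
  refine (measure_mono hsub).trans ((hμ _ _ (by positivity)).trans_eq ?_)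
  rw [mul_assoc, ← ENNReal.ofReal_mul (by positivity), ← Real.mul_rpow (by positivity) hr.le]

lemma IsCompact.exists_measure_preimage_closedBall_le {M Z ι : Type*} [Fintype ι] [MetricSpace M]
    [SecondCountableTopology M] [MeasurableSpace M] [BorelSpace M] {φ : M → ι → ℝ}
    (hφ : LipschitzWith 1 φ) {L : NNReal} (hL : AntilipschitzWith L φ) [PseudoMetricSpace Z]
    {f : M → Z} {K O : Set M} (hK : IsCompact K) (hO : IsOpen O)
    (hf : ∀ x ∈ K ∩ O, ∃ u ∈ nhds x, ∃ N : NNReal, AntilipschitzWith N (u.domRestrict f))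
    {s : NNReal} (hs : 0 < s) (hdim : s < dimH (K ∩ O)) :
    ∃ K' ⊆ K ∩ O, IsCompact K' ∧ ∃ μ : Measure K', IsProbabilityMeasure μ ∧ ∃ C : ℝ≥0∞, C ≠ ∞ ∧
      ∀ z r, 0 < r → μ {x | f x ∈ Metric.closedBall z r} ≤ C * ENNReal.ofReal (r ^ (s : ℝ)) := by
  obtain ⟨x, hx, hxdim⟩ := exists_mem_nhdsWithin_lt_dimH_of_lt_dimH hdim
  obtain ⟨u, hu, N, hN⟩ := hf x hx
  obtain ⟨ε, hε, hball⟩ := Metric.nhds_basis_closedBall.mem_iff.1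
    (Filter.inter_mem hu (hO.mem_nhds hx.2))
  have hKc : IsCompact (K ∩ Metric.closedBall x ε) := hK.inter_right Metric.isClosed_closedBall
  refine ⟨K ∩ Metric.closedBall x ε, fun y hy => ⟨hy.1, (hball hy.2).2⟩, hKc, ?_⟩
  set K' := K ∩ Metric.closedBall x ε
  have : CompactSpace K' := isCompact_iff_compactSpace.1 hKc
  have hK'dim : s < dimH K' := hxdim _ <| by
    refine Filter.mem_of_superset (Filter.inter_mem self_mem_nhdsWithin
      (mem_nhdsWithin_of_mem_nhds (Metric.closedBall_mem_nhds x hε))) ?_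
    exact fun y hy => ⟨hy.1.1, hy.2⟩
  have hμH : Measure.hausdorffMeasure s (Set.univ : Set K') ≠ 0 := by
    have hiso : Isometry (Subtype.val : K' → M) := isometry_subtype_coe
    rw [← hiso.hausdorffMeasure_image (Or.inl s.coe_nonneg), Set.image_univ, Subtype.range_coe,
      hausdorffMeasure_of_lt_dimH hK'dim]
    exact ENNReal.top_ne_zero
  obtain ⟨μ, hμ, C, hC, hball'⟩ := exists_isProbabilityMeasure_closedBall_le
    (φ := fun x : K' => φ x) ((hφ.comp (LipschitzWith.subtype_val K')).weaken (by simp))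
    (hL.comp (AntilipschitzWith.subtype_coe K')) (NNReal.coe_pos.2 hs) hμH
  have hN' : AntilipschitzWith N fun y : K' => f y := fun y z =>
    hN ⟨y, (hball y.2.2).1⟩ ⟨z, (hball z.2.2).1⟩
  exact ⟨μ, hμ, _, ENNReal.mul_ne_top hC ENNReal.ofReal_ne_top, fun z r hr =>
    hN'.measure_preimage_closedBall_le hball' z hr⟩

lemma volume_image_inner_pos {E : Type*} [NormedAddCommGroup E] [InnerProductSpace ℝ E]
    [MeasurableSpace E] [BorelSpace E] {σ : Measure E} [IsProbabilityMeasure σ] {v : E}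
    (h : ∫⁻ ξ : ℝ, ‖charFun (σ.withDensity fun x => ENNReal.ofReal (Real.exp (-‖x‖ ^ 2 / 2)))
      (ξ • v)‖ₑ ^ 2 < ∞) {K : Set E} (hK : IsCompact K) (hσK : σ Kᶜ = 0) :
    0 < volume ((fun x => inner ℝ x v) '' K) := by
  set σ' := σ.withDensity fun x => ENNReal.ofReal (Real.exp (-‖x‖ ^ 2 / 2))
  have hdens : Measurable fun x : E => ENNReal.ofReal (Real.exp (-‖x‖ ^ 2 / 2)) := by fun_prop
  have hinner : Measurable fun x : E => (inner ℝ x v : ℝ) := by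
    have : Continuous fun x : E => (inner ℝ x v : ℝ) := by fun_prop
    exact this.measurable
  have hfin : IsFiniteMeasure σ' := isFiniteMeasure_withDensity <| ne_top_of_le_ne_top
    ENNReal.one_ne_top <| (lintegral_mono fun x => by
      rw [ENNReal.ofReal_le_one, Real.exp_le_one_iff]
      have : 0 ≤ ‖x‖ ^ 2 := by positivity
      linarith).trans_eq (by simp)
  have hne : σ' ≠ 0 := by
    intro h0
    have := withDensity_eq_zero hdens.aemeasurable h0
    obtain ⟨x, hx⟩ := this.exists
    have : 0 < Real.exp (-‖x‖ ^ 2 / 2) := Real.exp_pos _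
    simp at hx
    linarith
  refine volume_pos_of_lintegral_charFun_sq_lt_top (σ := σ'.map fun x => inner ℝ x v) ?_ ?_
    (hK.image (by fun_prop)) ?_
  · rwa [Ne, Measure.map_eq_zero_iff hinner.aemeasurable]
  · refine lt_of_eq_of_lt (lintegral_congr fun ξ => ?_) h
    congr 2
    rw [charFun_apply, charFun_apply, integral_map hinner.aemeasurable (by fun_prop)]
    congr with x
    simp [inner_smul_right, mul_comm]
  · rw [Measure.map_apply hinner (hK.image (by fun_prop)).measurableSet.compl]
    refine measure_mono_null (t := Kᶜ) ?_ (withDensity_absolutelyContinuous _ _ hσK)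
    exact fun x hx hxK => hx ⟨x, hxK, rfl⟩

open scoped Pointwise in
lemma volume_image_const_add_mul_pos {S : Set ℝ} (hS : 0 < volume S) (c : ℝ) {m : ℝ}
    (hm : m ≠ 0) : 0 < volume ((fun u => c + m * u) '' S) := by
  have : (fun u => c + m * u) '' S = c +ᵥ m • S := by
    rw [← Set.image_smul, ← Set.image_vadd, Set.image_image]
    rfl
  rw [this, measure_vadd, Measure.addHaar_smul]
  exact ENNReal.mul_pos (by simpa using hm) hS.ne'

lemma exists_antilipschitzWith_domRestrict_of_rank_fderiv {E : Type*}
    [NormedAddCommGroup E] [NormedSpace ℝ E] [FiniteDimensional ℝ E] {P : E → E} {x : E}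
    (hP : ContDiffAt ℝ 1 P x)
    (hrank : LinearMap.rank (fderiv ℝ P x).toLinearMap = Module.finrank ℝ E) :
    ∃ u ∈ nhds x, ∃ N : NNReal, AntilipschitzWith N (u.domRestrict P) := by
  have hsurj : Function.Surjective (fderiv ℝ P x).toLinearMap := by
    rw [← LinearMap.range_eq_top]
    apply Submodule.eq_top_of_finrank_eq
    exact Module.finrank_eq_of_rank_eq hrank
  have hinj := LinearMap.injective_iff_surjective.2 hsurj
  set e := (LinearEquiv.ofBijective _ ⟨hinj, hsurj⟩).toContinuousLinearEquiv
  have he : (e : E →L[ℝ] E) = fderiv ℝ P x := by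
    ext
    rfl
  have := hP.hasStrictFDerivAt one_ne_zero
  rw [← he] at this
  exact this.exists_antilipschitzWith_domRestrict

lemma ENNReal.exists_nnreal_lt_lt_add {a b m : ℝ≥0∞} (ha : a ≤ m) (hb : b ≤ m) (hm : m ≠ ∞)
    (hab : m < a + b) :
    ∃ s t : NNReal, 0 < s ∧ 0 < t ∧ (s : ℝ≥0∞) < a ∧ (t : ℝ≥0∞) < b ∧ m < s + t := by
  lift m to NNReal using hm
  lift a to NNReal using ne_top_of_le_ne_top ENNReal.coe_ne_top ha
  lift b to NNReal using ne_top_of_le_ne_top ENNReal.coe_ne_top hb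
  norm_cast at *
  rw [← NNReal.coe_le_coe] at ha hb
  rw [← NNReal.coe_lt_coe, NNReal.coe_add] at hab
  obtain ⟨s, hs⟩ : ∃ s : NNReal, (s : ℝ) = a - (a + b - m) / 3 :=
    ⟨_, Real.coe_toNNReal _ (by linarith [b.coe_nonneg, a.coe_nonneg])⟩
  obtain ⟨t, ht⟩ : ∃ t : NNReal, (t : ℝ) = b - (a + b - m) / 3 :=
    ⟨_, Real.coe_toNNReal _ (by linarith [b.coe_nonneg, a.coe_nonneg])⟩
  refine ⟨s, t, ?_, ?_, ?_, ?_, ?_⟩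
  all_goals
    rw [← NNReal.coe_lt_coe]
    push_cast
    linarith

/-- for `f(x,y) = a y^{r_{n+1}} + Σ_{k=1}^n P_k(x) y^{r_k}` with `P` smooth of
rank `n` on `U` and `r_i ≠ r_j` for some `1 ≤ i < j ≤ n`, if `A ⊆ U`, `B ⊆ ℝ` are compact with
`dim_H A + dim_H B > n`, then `f(A,y)` has positive Lebesgue measure for some `y ∈ B`. -/
theorem stmt_4 (n : ℕ) (hn : 2 ≤ n) (a : ℝ) (r : Fin n → ℕ) (rlast : ℕ)
    (hr : ∃ i j : Fin n, i < j ∧ r i ≠ r j)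
    (U : Set (EuclideanSpace ℝ (Fin n))) (hU : IsOpen U)
    (P : EuclideanSpace ℝ (Fin n) → EuclideanSpace ℝ (Fin n))
    (hP : ContDiff ℝ (⊤ : ℕ∞) P)
    (hPrank : ∀ x ∈ U, LinearMap.rank (fderiv ℝ P x).toLinearMap = n)
    (A : Set (EuclideanSpace ℝ (Fin n))) (B : Set ℝ)
    (hA : IsCompact A) (hB : IsCompact B) (hAU : A ⊆ U)
    (hdim : dimH A + dimH B > (n : ℝ≥0∞)) :
    ∃ y ∈ B, 0 < volume ((fun x => a * y ^ rlast + ∑ k, P x k * y ^ r k) '' A) := by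
  obtain ⟨i, j, hij⟩ : ∃ i j : Fin n, r i < r j := by
    obtain ⟨i, j, -, hne⟩ := hr
    rcases hne.lt_or_gt with h | h
    exacts [⟨i, j, h⟩, ⟨j, i, h⟩]
  have hAdim : dimH A ≤ n := by
    simpa using (dimH_mono (Set.subset_univ A)).trans_eq
      (Real.dimH_univ_eq_finrank (EuclideanSpace ℝ (Fin n)))
  have hBdim : dimH B ≤ 1 := by
    simpa using (dimH_mono (Set.subset_univ B)).trans_eq (Real.dimH_univ_eq_finrank ℝ)
  have hn1 : (1 : ℝ≥0∞) ≤ n := by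
    exact_mod_cast (one_le_two.trans hn)
  have hB0 : dimH (B ∩ {0}ᶜ) = dimH B := by
    refine le_antisymm (dimH_mono Set.inter_subset_left) ?_
    refine (dimH_mono fun y hy => ?_ : dimH B ≤ dimH (B ∩ {0}ᶜ ∪ {0})).trans ?_
    · by_cases h : y = 0
      exacts [Or.inr h, Or.inl ⟨hy, h⟩]
    · rw [dimH_union, dimH_singleton]
      exact max_le le_rfl zero_le
  obtain ⟨s, t, hs, ht, hsA, htB, hst⟩ := ENNReal.exists_nnreal_lt_lt_add hAdim
    (hBdim.trans hn1) (ENNReal.natCast_ne_top n) hdim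
  obtain ⟨A', hA'A, hA', μ, hμ, C', hC', hμball⟩ :=
    hA.exists_measure_preimage_closedBall_le (f := P) (PiLp.lipschitzWith_ofLp 2 _)
      (PiLp.antilipschitzWith_ofLp 2 _) isOpen_univ (fun x hx =>
        exists_antilipschitzWith_domRestrict_of_rank_fderiv
          (hP.contDiffAt.of_le (by exact_mod_cast le_top)) (by simpa using hPrank x (hAU hx.1)))
      hs (by simpa using hsA)
  obtain ⟨B', hB'B, hB', ν, hν, C, hC, hνball⟩ :=
    hB.exists_measure_preimage_closedBall_le (f := fun y : ℝ => y ^ (r j - r i))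
      (φ := fun y (_ : Unit) => y) (LipschitzWith.of_edist_le fun y z => by simp [edist_pi_def])
      (L := 1) (fun y z => by simp [edist_pi_def]) isOpen_compl_singleton (fun y hy =>
        ((hasStrictDerivAt_pow (r j - r i) y).hasStrictFDerivAt_equiv (mul_ne_zero
          (Nat.cast_ne_zero.2 (Nat.sub_pos_of_lt hij).ne')
          (pow_ne_zero _ hy.2))).exists_antilipschitzWith_domRestrict)
      ht (by rwa [hB0])
  have hB'0 : ∀ y : B', (y : ℝ) ≠ 0 := fun y => (hB'B y.2).2
  set e : B' → EuclideanSpace ℝ (Fin n) := fun y =>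
    WithLp.toLp 2 fun k => (y : ℝ) ^ r k / (y : ℝ) ^ r i
  have hec : Continuous e := by
    refine (PiLp.continuous_toLp 2 _).comp (continuous_pi fun k => ?_)
    exact (by fun_prop : Continuous fun y : B' => (y : ℝ) ^ r k).div (by fun_prop)
      fun y => pow_ne_zero _ (hB'0 y)
  have : CompactSpace B' := isCompact_iff_compactSpace.1 hB'
  obtain ⟨R, hR⟩ := (isCompact_range hec).isBounded.exists_norm_le
  have hPA : Measurable fun x : A' => P x := (hP.continuous.comp continuous_subtype_val).measurable
  have hσ : IsProbabilityMeasure (μ.map fun x : A' => P x) :=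
    Measure.isProbabilityMeasure_map hPA.aemeasurable
  have hlt : (n : ℝ) < s + t := by exact_mod_cast hst
  have htle : (t : ℝ) ≤ 1 := by
    have := htB.le.trans hBdim
    exact_mod_cast this
  have hfin := lintegral_charFun_smul_sq_lt_top (i := i) (j := j) (ν := ν) hec.measurable
    (fun y => hR _ ⟨y, rfl⟩) (fun y => div_self (pow_ne_zero _ (hB'0 y))) (NNReal.coe_pos.2 hs)
    (NNReal.coe_pos.2 ht) (by linarith) (by simpa using hlt) hC (fun v ρ hρ => by
      convert hνball v ρ hρ using 3
      ext y
      change |(y : ℝ) ^ r j / (y : ℝ) ^ r i - v| ≤ ρ ↔ |(y : ℝ) ^ (r j - r i) - v| ≤ ρ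
      rw [pow_sub₀ _ (hB'0 y) hij.le, div_eq_mul_inv])
    (σ := μ.map fun x : A' => P x) hC' (fun x ρ hρ => by
      rw [Measure.map_apply hPA Metric.isClosed_closedBall.measurableSet]
      exact hμball x ρ hρ)
  obtain ⟨y, hy⟩ : ∃ y, ∫⁻ ξ : ℝ, ‖charFun ((μ.map fun x : A' => P x).withDensity
      fun x => ENNReal.ofReal (Real.exp (-‖x‖ ^ 2 / 2))) (ξ • e y)‖ₑ ^ 2 < ∞ := by
    by_contra! h
    refine hfin.not_ge ?_
    calc ∞ = ∫⁻ _, ∞ ∂ν := by simp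
      _ ≤ _ := lintegral_mono fun y => h y
  refine ⟨y, (hB'B y.2).1, ?_⟩
  have hpos := volume_image_inner_pos hy (hA'.image hP.continuous) (by
    rw [Measure.map_apply hPA (hA'.image hP.continuous).measurableSet.compl]
    convert measure_empty (μ := μ)
    ext x
    simp only [Set.mem_preimage, Set.mem_compl_iff, Set.mem_empty_iff_false, iff_false, not_not]
    exact ⟨x, x.2, rfl⟩)
  refine (volume_image_const_add_mul_pos hpos (a * (y : ℝ) ^ rlast)
    (pow_ne_zero (r i) (hB'0 y))).trans_le (measure_mono ?_)
  rintro _ ⟨_, ⟨_, ⟨x, hx, rfl⟩, rfl⟩, rfl⟩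
  refine ⟨x, (hA'A hx).1, ?_⟩
  simp only [PiLp.inner_apply, Finset.mul_sum]
  congr 1
  refine Finset.sum_congr rfl fun k _ => ?_
  have hyi := pow_ne_zero (r i) (hB'0 y)
  simp only [e, RCLike.inner_apply, conj_trivial]
  field_simp
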